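/- Let 𝓔, ℱ_e, ℱ_o ⊆ 𝒫([n]) and let ν be an integrable measure on ℝⁿ. Then ν is universal on the space ℳ^int(𝓔; ℱ_e, ℱ_o) of integrable measures concentrated on ⋃_{E∈𝓔} A_E that are even under T_F for all F ∈ ℱ_e and odd under T_F for all F ∈ ℱ_o, if and only if δ_J ⊛ R_E P_E(ν) ≠ 0 for every E ∈ 𝓔 and every J ∈ 𝒥(E; ℱ_e, ℱ_o). -/

import Mathlib

open MeasureTheory
open scoped ENNReal symmDiff Classical

noncomputable section

/-- The Euclidean (ℓ²) norm on `Fin n → ℝ`. -/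
def e2 {n : ℕ} (x : Fin n → ℝ) : ℝ := Real.sqrt (∑ i, (x i) ^ 2)

/-- The unit sphere `S^{n-1}` in `ℝⁿ`. -/
def Sph (n : ℕ) : Set (Fin n → ℝ) := {x | e2 x = 1}

/-- The set `A_E = {x : xᵢ ≠ 0 ↔ i ∈ E}`. -/
def setA {n : ℕ} (E : Finset (Fin n)) : Set (Fin n → ℝ) := {x | ∀ i, x i ≠ 0 ↔ i ∈ E}

/-- Finite signed Borel measures on `ℝⁿ`. -/
abbrev SM (n : ℕ) := MeasureTheory.SignedMeasure (Fin n → ℝ)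

/-- A (finite) measure regarded as a signed measure (junk value `0` if not finite). -/
def toSigned {X : Type*} [MeasurableSpace X] (ρ : Measure X) : SignedMeasure X :=
  if h : IsFiniteMeasure ρ then @Measure.toSignedMeasure X _ ρ h else 0

/-- Multiplicative convolution of two non-negative measures. -/
def mconvPos {n : ℕ} (ρ σ : Measure (Fin n → ℝ)) : Measure (Fin n → ℝ) :=
  (ρ.prod σ).map (fun p => p.1 * p.2)

/-- Multiplicative convolution `μ ⊛ ν` of two signed measures, via Jordan decomposition. -/
def mconv {n : ℕ} (μ ν : SM n) : SM n :=
  toSigned (mconvPos μ.toJordanDecomposition.posPart ν.toJordanDecomposition.posPart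
      + mconvPos μ.toJordanDecomposition.negPart ν.toJordanDecomposition.negPart)
  - toSigned (mconvPos μ.toJordanDecomposition.posPart ν.toJordanDecomposition.negPart
      + mconvPos μ.toJordanDecomposition.negPart ν.toJordanDecomposition.posPart)

/-- `μ` is integrable: `∫ ‖x‖₂ d|μ| < ∞`. -/
def IntegrableSM {n : ℕ} (μ : SM n) : Prop :=
  ∫⁻ x, ENNReal.ofReal (e2 x) ∂μ.totalVariation < ⊤

/-- `μ` is concentrated on `A`:  `|μ|(Aᶜ) = 0`. -/
def ConcOn {n : ℕ} (μ : SM n) (A : Set (Fin n → ℝ)) : Prop := μ.totalVariation Aᶜ = 0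

/-- The multiple reflection `T_E` on `ℝⁿ`. -/
def flipE {n : ℕ} (E : Finset (Fin n)) (x : Fin n → ℝ) : Fin n → ℝ :=
  fun i => if i ∈ E then -x i else x i

/-- Pushforward of a signed measure under `T_E`. -/
def Tmap {n : ℕ} (E : Finset (Fin n)) (μ : SM n) : SM n := μ.map (flipE E)

def EvenUnder {n : ℕ} (μ : SM n) (E : Finset (Fin n)) : Prop := Tmap E μ = μ
def OddUnder {n : ℕ} (μ : SM n) (E : Finset (Fin n)) : Prop := Tmap E μ = -μ

/-- Orthogonal projection onto the coordinate subspace `H_E`. -/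
def projE {n : ℕ} (E : Finset (Fin n)) (x : Fin n → ℝ) : Fin n → ℝ :=
  fun i => if i ∈ E then x i else 0

/-- `P_E(μ)`: pushforward under `projE`. -/
def Pmap {n : ℕ} (E : Finset (Fin n)) (μ : SM n) : SM n := μ.map (projE E)

/-- `R_E(μ) = μ_E`: restriction to `A_E`. -/
def Rres {n : ℕ} (E : Finset (Fin n)) (μ : SM n) : SM n := μ.restrict (setA E)

/-- Sign vector attached to `b : Fin n → Bool`. -/
def signVec {n : ℕ} (b : Fin n → Bool) : Fin n → ℝ := fun i => if b i then 1 else -1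

/-- The measure `δ_J = 2^{-n} ∑_{s ∈ 𝒮ⁿ} σ_J(s) δ_s`. -/
def deltaJ {n : ℕ} (J : Finset (Fin n)) : SM n :=
  ((2 : ℝ) ^ n)⁻¹ •
    ∑ b : Fin n → Bool,
      (∏ j ∈ J, (if b j then (1 : ℝ) else -1)) • toSigned (Measure.dirac (signVec b))

/-- `𝒥(E; Fe, Fo)`. -/
def JsetE {n : ℕ} (E : Finset (Fin n)) (Fe Fo : Set (Finset (Fin n))) :
    Set (Finset (Fin n)) :=
  {J | J ⊆ E ∧ (∀ F ∈ Fe, Even (J ∩ F).card) ∧ (∀ F ∈ Fo, Odd (J ∩ F).card)}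

/-- `𝒥(Fe, Fo) = 𝒥([n]; Fe, Fo)`. -/
def Jset {n : ℕ} (Fe Fo : Set (Finset (Fin n))) : Set (Finset (Fin n)) :=
  {J | (∀ F ∈ Fe, Even (J ∩ F).card) ∧ (∀ F ∈ Fo, Odd (J ∩ F).card)}

/-- `G` has a representation `G = F₁ Δ … Δ F_m` with each `Fᵢ` drawn from `Fe` or `Fo`,
in which the number of terms drawn from `Fo` is even (`odd = false`) or odd (`odd = true`). -/
def HasRep {n : ℕ} (Fe Fo : Set (Finset (Fin n))) (G : Finset (Fin n)) (odd : Bool) : Prop :=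
  ∃ l : List (Finset (Fin n) × Bool),
    (∀ p ∈ l, if p.2 then p.1 ∈ Fo else p.1 ∈ Fe) ∧
    (l.map Prod.fst).foldr (· ∆ ·) ∅ = G ∧
    (l.countP (fun p => p.2)) % 2 = (if odd then 1 else 0)

/-- The generating pair `(Fe, Fo)` is proper: the even and odd parts of the generated group
are disjoint. -/
def ProperPair {n : ℕ} (Fe Fo : Set (Finset (Fin n))) : Prop :=
  ∀ G : Finset (Fin n), ¬ (HasRep Fe Fo G false ∧ HasRep Fe Fo G true)

/-- `ℳ^int(A; Fe, Fo)`: integrable signed measures concentrated on `A`, even under `T_F`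
for `F ∈ Fe` and odd under `T_F` for `F ∈ Fo`. -/
def MclassInt {n : ℕ} (A : Set (Fin n → ℝ)) (Fe Fo : Set (Finset (Fin n))) : Set (SM n) :=
  {μ | IntegrableSM μ ∧ ConcOn μ A ∧ (∀ F ∈ Fe, EvenUnder μ F) ∧ (∀ F ∈ Fo, OddUnder μ F)}

/-- `ν` is universal on `𝒜`. -/
def Universal {n : ℕ} (ν : SM n) (𝒜 : Set (SM n)) : Prop :=
  ∀ μ ∈ 𝒜, mconv ν μ = 0 → μ = 0

/-- Radial projection of a non-negative measure. -/
def radPos {n : ℕ} (ρ : Measure (Fin n → ℝ)) : Measure (Fin n → ℝ) :=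
  (ρ.withDensity fun x => ENNReal.ofReal (e2 x)).map (fun x => (e2 x)⁻¹ • x)

/-- Radial projection `P_S` of a signed measure. -/
def PS {n : ℕ} (μ : SM n) : SM n :=
  toSigned (radPos μ.toJordanDecomposition.posPart) -
    toSigned (radPos μ.toJordanDecomposition.negPart)

/-- The spherical product `μ ⊛_S ν = P_S(μ ⊛ ν)`. -/
def mconvS {n : ℕ} (μ ν : SM n) : SM n := PS (mconv μ ν)

/-- `ν` is spherically universal on `𝒜`. -/
def SphUniversal {n : ℕ} (ν : SM n) (𝒜 : Set (SM n)) : Prop :=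
  ∀ μ ∈ 𝒜, mconvS ν μ = 0 → μ = 0

/-- The unconditional symmetrisation `M_unc`. -/
def Munc {n : ℕ} (μ : SM n) : SM n := ((2 : ℝ) ^ n)⁻¹ • ∑ E : Finset (Fin n), Tmap E μ

/-- Integral of `f` against a signed measure. -/
def sInt {n : ℕ} (μ : SM n) (f : (Fin n → ℝ) → ℝ) : ℝ :=
  (∫ x, f x ∂μ.toJordanDecomposition.posPart) - ∫ x, f x ∂μ.toJordanDecomposition.negPart

/-- `δ₁ ⊗ μ`: the lifting of `μ` to a measure on `ℝ^{n+1}`, with an extra `0`-th coordinate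
carrying a unit atom at `1`. -/
def lift0 {n : ℕ} (μ : SM n) : SM (n + 1) := μ.map (fun x => Fin.cons 1 x)

/-- Symmetrisation about the origin. -/
def Msym {n : ℕ} (μ : SM n) : SM n := (2 : ℝ)⁻¹ • (μ + μ.map (fun x => -x))

/-- The lifting `L(μ) = P_S(M_sym(δ₁ ⊗ μ))`. -/
def Lift {n : ℕ} (μ : SM n) : SM (n + 1) := PS (Msym (lift0 μ))

section Decomposition

variable {X Y : Type*} [MeasurableSpace X] [MeasurableSpace Y]

/-- `μ = a - b` as set functions on measurable sets. -/
def IsDiff (μ : SignedMeasure X) (a b : Measure X) : Prop :=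
  ∀ A, MeasurableSet A → μ A = a.real A - b.real A

lemma isDiff_jordan (μ : SignedMeasure X) :
    IsDiff μ μ.toJordanDecomposition.posPart μ.toJordanDecomposition.negPart :=
  fun _ hA => μ.apply_eq_posPart_real_sub_negPart_real hA

lemma toSigned_apply (a : Measure X) [IsFiniteMeasure a] {A : Set X} (hA : MeasurableSet A) :
    toSigned a A = a.real A := by
  rw [toSigned, dif_pos ‹IsFiniteMeasure a›, Measure.toSignedMeasure_apply_measurable hA]

lemma isDiff_toSigned_sub (a b : Measure X) [IsFiniteMeasure a] [IsFiniteMeasure b] :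
    IsDiff (toSigned a - toSigned b) a b := fun A hA => by
  rw [_root_.sub_apply, toSigned_apply a hA, toSigned_apply b hA]

lemma isDiff_toSigned (a : Measure X) [IsFiniteMeasure a] : IsDiff (toSigned a) a 0 :=
  fun A hA => by simp [toSigned_apply a hA]

namespace IsDiff

variable {μ ν : SignedMeasure X} {a b c d : Measure X}

lemma add [IsFiniteMeasure a] [IsFiniteMeasure b] [IsFiniteMeasure c] [IsFiniteMeasure d]
    (h : IsDiff μ a b) (h' : IsDiff ν c d) : IsDiff (μ + ν) (a + c) (b + d) := fun A hA => by
  rw [_root_.add_apply, h A hA, h' A hA, measureReal_add_apply, measureReal_add_apply]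
  ring

lemma map (h : IsDiff μ a b) {g : X → Y} (hg : Measurable g) :
    IsDiff (μ.map g) (a.map g) (b.map g) := fun A hA => by
  rw [VectorMeasure.map_apply _ hg hA, h _ (hg hA), map_measureReal_apply hg hA,
    map_measureReal_apply hg hA]

lemma restrict (h : IsDiff μ a b) {S : Set X} (hS : MeasurableSet S) :
    IsDiff (μ.restrict S) (a.restrict S) (b.restrict S) := fun A hA => by
  rw [VectorMeasure.restrict_apply _ hS hA, h _ (hA.inter hS), measureReal_restrict_apply hA,
    measureReal_restrict_apply hA]

lemma add_eq_add [IsFiniteMeasure a] [IsFiniteMeasure b] [IsFiniteMeasure c] [IsFiniteMeasure d]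
    (h : IsDiff μ a b) (h' : IsDiff μ c d) : a + d = c + b := by
  refine Measure.ext fun A hA => ?_
  have := (h A hA).symm.trans (h' A hA)
  rw [← measureReal_eq_measureReal_iff, measureReal_add_apply, measureReal_add_apply]
  linarith

lemma posPart_le [IsFiniteMeasure a] [IsFiniteMeasure b] (h : IsDiff μ a b) :
    μ.toJordanDecomposition.posPart ≤ a := by
  obtain ⟨i, hi, hi0, -, hp, -⟩ := μ.toJordanDecomposition_spec
  refine Measure.le_iff.2 fun A hA => ?_
  have h1 : μ.toJordanDecomposition.posPart.real A = a.real (i ∩ A) - b.real (i ∩ A) := by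
    rw [← h _ (hi.inter hA), hp, SignedMeasure.toMeasureOfZeroLE_real_apply _ hi0 hi hA]
  have h2 : μ.toJordanDecomposition.posPart.real A ≤ a.real A := by
    have : a.real (i ∩ A) ≤ a.real A := measureReal_mono Set.inter_subset_right
    have : 0 ≤ b.real (i ∩ A) := measureReal_nonneg
    linarith
  exact (ENNReal.toReal_le_toReal (measure_ne_top _ _) (measure_ne_top _ _)).1 h2

lemma neg (h : IsDiff μ a b) : IsDiff (-μ) b a := fun A hA => by
  rw [_root_.neg_apply, h A hA, neg_sub]

lemma smul_nnreal (h : IsDiff μ a b) (r : NNReal) : IsDiff ((r : ℝ) • μ) (r • a) (r • b) :=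
  fun A hA => by
  rw [_root_.smul_apply, h A hA, measureReal_nnreal_smul_apply, measureReal_nnreal_smul_apply,
    smul_eq_mul, mul_sub]

lemma negPart_le [IsFiniteMeasure a] [IsFiniteMeasure b] (h : IsDiff μ a b) :
    μ.toJordanDecomposition.negPart ≤ b := by
  simpa [SignedMeasure.toJordanDecomposition_neg] using h.neg.posPart_le

lemma totalVariation_le [IsFiniteMeasure a] [IsFiniteMeasure b] (h : IsDiff μ a b) :
    μ.totalVariation ≤ a + b := add_le_add h.posPart_le h.negPart_le

end IsDiff

/-- Complex-valued integral against a signed measure. -/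
def cInt (μ : SignedMeasure X) (f : X → ℂ) : ℂ :=
  (∫ x, f x ∂μ.toJordanDecomposition.posPart) - ∫ x, f x ∂μ.toJordanDecomposition.negPart

lemma IsDiff.cInt_eq {μ : SignedMeasure X} {a b : Measure X} [IsFiniteMeasure a]
    [IsFiniteMeasure b] (h : IsDiff μ a b) {f : X → ℂ} (ha : Integrable f a)
    (hb : Integrable f b) : cInt μ f = (∫ x, f x ∂a) - ∫ x, f x ∂b := by
  have hp := ha.mono_measure h.posPart_le
  have hq := hb.mono_measure h.negPart_le
  have := congrArg (fun m => ∫ x, f x ∂m) (h.add_eq_add (isDiff_jordan μ))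
  simp only [integral_add_measure ha hq, integral_add_measure hp hb] at this
  rw [cInt]
  linear_combination -this

lemma totalVariation_eq_zero_of_forall {μ : SignedMeasure X} {S : Set X} (hS : MeasurableSet S)
    (h : μ.restrict S = 0) : μ.totalVariation S = 0 := by
  have hd := (isDiff_jordan μ).restrict hS
  rw [h] at hd
  obtain ⟨i, hi, hi0, hi1, hp, hq⟩ := μ.toJordanDecomposition_spec
  have key : ∀ B, MeasurableSet B → B ⊆ S → μ B = 0 := fun B hB hBS => by
    have := VectorMeasure.restrict_apply μ hS hB
    rw [h, Set.inter_eq_left.2 hBS] at this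
    simpa using this.symm
  have h1 : μ.toJordanDecomposition.posPart.real S = 0 := by
    rw [hp, SignedMeasure.toMeasureOfZeroLE_real_apply _ hi0 hi hS]
    exact key _ (hi.inter hS) Set.inter_subset_right
  have h2 : μ.toJordanDecomposition.negPart.real S = 0 := by
    rw [hq, SignedMeasure.toMeasureOfLEZero_real_apply _ hi1 hi.compl hS,
      key _ (hi.compl.inter hS) Set.inter_subset_right, neg_zero]
  rw [measureReal_eq_zero_iff] at h1 h2
  simp [SignedMeasure.totalVariation, h1, h2]

lemma eq_zero_of_totalVariation_univ {μ : SignedMeasure X} (h : μ.totalVariation Set.univ = 0) :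
    μ = 0 := by
  ext A hA
  exact μ.null_of_totalVariation_zero (measure_mono_null (Set.subset_univ A) h)

lemma eq_zero_of_posPart_eq_negPart {μ : SignedMeasure X}
    (h : μ.toJordanDecomposition.posPart = μ.toJordanDecomposition.negPart) : μ = 0 := by
  ext A hA
  rw [isDiff_jordan μ A hA, h, sub_self]
  rfl

end Decomposition

section Moment

variable {n : ℕ}

lemma e2_nonneg (x : Fin n → ℝ) : 0 ≤ e2 x := Real.sqrt_nonneg _

lemma abs_le_e2 (x : Fin n → ℝ) (i : Fin n) : |x i| ≤ e2 x := by
  rw [← Real.sqrt_sq_eq_abs]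
  exact Real.sqrt_le_sqrt (Finset.single_le_sum (f := fun i => x i ^ 2)
    (fun j _ => sq_nonneg _) (Finset.mem_univ i))

lemma measurable_e2 : Measurable (e2 : (Fin n → ℝ) → ℝ) := by
  unfold e2
  fun_prop

lemma e2_mul_le (x y : Fin n → ℝ) : e2 (x * y) ≤ e2 x * e2 y := by
  rw [e2, e2, e2, ← Real.sqrt_mul (Finset.sum_nonneg fun i _ => sq_nonneg _)]
  refine Real.sqrt_le_sqrt ?_
  rw [Finset.sum_mul]
  refine Finset.sum_le_sum fun i _ => ?_
  rw [Pi.mul_apply, mul_pow]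
  exact mul_le_mul_of_nonneg_left (Finset.single_le_sum (f := fun i => y i ^ 2)
    (fun j _ => sq_nonneg _) (Finset.mem_univ i)) (sq_nonneg _)

lemma e2_flipE (F : Finset (Fin n)) (x : Fin n → ℝ) : e2 (flipE F x) = e2 x := by
  unfold e2 flipE
  congr 1
  refine Finset.sum_congr rfl fun i _ => ?_
  split_ifs <;> ring

lemma e2_projE_le (E : Finset (Fin n)) (x : Fin n → ℝ) : e2 (projE E x) ≤ e2 x := by
  unfold e2 projE
  refine Real.sqrt_le_sqrt (Finset.sum_le_sum fun i _ => ?_)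
  split_ifs <;> nlinarith [sq_nonneg (x i)]

lemma integrable_e2_iff {m : Measure (Fin n → ℝ)} :
    Integrable e2 m ↔ ∫⁻ x, ENNReal.ofReal (e2 x) ∂m < ⊤ :=
  ⟨fun h => (hasFiniteIntegral_iff_ofReal (.of_forall e2_nonneg)).1 h.2,
    fun h => ⟨measurable_e2.aestronglyMeasurable,
      (hasFiniteIntegral_iff_ofReal (.of_forall e2_nonneg)).2 h⟩⟩

lemma IntegrableSM.posPart {μ : SM n} (h : IntegrableSM μ) :
    Integrable e2 μ.toJordanDecomposition.posPart :=
  (integrable_e2_iff.2 h).mono_measure (Measure.le_add_right le_rfl)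

lemma IntegrableSM.negPart {μ : SM n} (h : IntegrableSM μ) :
    Integrable e2 μ.toJordanDecomposition.negPart :=
  (integrable_e2_iff.2 h).mono_measure (Measure.le_add_left le_rfl)

lemma IsDiff.integrableSM {μ : SM n} {a b : Measure (Fin n → ℝ)} [IsFiniteMeasure a]
    [IsFiniteMeasure b] (h : IsDiff μ a b) (ha : Integrable e2 a) (hb : Integrable e2 b) :
    IntegrableSM μ :=
  integrable_e2_iff.1 ((ha.add_measure hb).mono_measure h.totalVariation_le)

lemma integrable_e2_map {a : Measure (Fin n → ℝ)} (ha : Integrable e2 a)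
    {g : (Fin n → ℝ) → Fin n → ℝ} (hg : Measurable g) (hle : ∀ x, e2 (g x) ≤ e2 x) :
    Integrable e2 (a.map g) := by
  rw [integrable_map_measure measurable_e2.aestronglyMeasurable hg.aemeasurable]
  refine ha.mono' (measurable_e2.comp hg).aestronglyMeasurable (.of_forall fun x => ?_)
  rw [Function.comp_apply, Real.norm_of_nonneg (e2_nonneg _)]
  exact hle x

lemma integrable_e2_mconvPos {a b : Measure (Fin n → ℝ)} [IsFiniteMeasure a] [IsFiniteMeasure b]
    (ha : Integrable e2 a) (hb : Integrable e2 b) : Integrable e2 (mconvPos a b) := by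
  have hm : Measurable fun p : (Fin n → ℝ) × (Fin n → ℝ) => p.1 * p.2 := by fun_prop
  rw [mconvPos, integrable_map_measure measurable_e2.aestronglyMeasurable hm.aemeasurable]
  refine (ha.mul_prod hb).mono' (measurable_e2.comp hm).aestronglyMeasurable
    (.of_forall fun p => ?_)
  rw [Function.comp_apply, Real.norm_of_nonneg (e2_nonneg _)]
  exact e2_mul_le _ _

instance isFiniteMeasure_mconvPos (a b : Measure (Fin n → ℝ)) [IsFiniteMeasure a]
    [IsFiniteMeasure b] : IsFiniteMeasure (mconvPos a b) := by
  unfold mconvPos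
  infer_instance

lemma isDiff_mconv (μ ν : SM n) : IsDiff (mconv μ ν)
    (mconvPos μ.toJordanDecomposition.posPart ν.toJordanDecomposition.posPart
      + mconvPos μ.toJordanDecomposition.negPart ν.toJordanDecomposition.negPart)
    (mconvPos μ.toJordanDecomposition.posPart ν.toJordanDecomposition.negPart
      + mconvPos μ.toJordanDecomposition.negPart ν.toJordanDecomposition.posPart) :=
  isDiff_toSigned_sub _ _

lemma IntegrableSM.mconv {μ ν : SM n} (hμ : IntegrableSM μ) (hν : IntegrableSM ν) :
    IntegrableSM (mconv μ ν) :=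
  (isDiff_mconv μ ν).integrableSM
    ((integrable_e2_mconvPos hμ.posPart hν.posPart).add_measure
      (integrable_e2_mconvPos hμ.negPart hν.negPart))
    ((integrable_e2_mconvPos hμ.posPart hν.negPart).add_measure
      (integrable_e2_mconvPos hμ.negPart hν.posPart))

lemma IntegrableSM.map {μ : SM n} (hμ : IntegrableSM μ)
    {g : (Fin n → ℝ) → Fin n → ℝ} (hg : Measurable g) (hle : ∀ x, e2 (g x) ≤ e2 x) :
    IntegrableSM (μ.map g) :=
  ((isDiff_jordan μ).map hg).integrableSM (integrable_e2_map hμ.posPart hg hle)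
    (integrable_e2_map hμ.negPart hg hle)

lemma IntegrableSM.restrict {μ : SM n} (hμ : IntegrableSM μ) {S : Set (Fin n → ℝ)}
    (hS : MeasurableSet S) : IntegrableSM (μ.restrict S) :=
  ((isDiff_jordan μ).restrict hS).integrableSM hμ.posPart.restrict hμ.negPart.restrict

lemma IntegrableSM.add {μ ν : SM n} (hμ : IntegrableSM μ) (hν : IntegrableSM ν) :
    IntegrableSM (μ + ν) :=
  ((isDiff_jordan μ).add (isDiff_jordan ν)).integrableSM (hμ.posPart.add_measure hν.posPart)
    (hμ.negPart.add_measure hν.negPart)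

lemma IntegrableSM.neg {μ : SM n} (hμ : IntegrableSM μ) : IntegrableSM (-μ) :=
  (isDiff_jordan μ).neg.integrableSM hμ.negPart hμ.posPart

lemma IntegrableSM.smul {μ : SM n} (hμ : IntegrableSM μ) (r : ℝ) : IntegrableSM (r • μ) := by
  have key (t : NNReal) : IntegrableSM ((t : ℝ) • μ) :=
    ((isDiff_jordan μ).smul_nnreal t).integrableSM hμ.posPart.smul_measure_nnreal
      hμ.negPart.smul_measure_nnreal
  rcases le_total 0 r with h | h
  · simpa only [Real.coe_toNNReal r h] using key r.toNNReal
  · have hr : r • μ = -((-r) • μ) := by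
      ext A hA
      simp
    rw [hr]
    simpa only [Real.coe_toNNReal _ (neg_nonneg.2 h)] using (key (-r).toNNReal).neg

lemma integrableSM_zero : IntegrableSM (0 : SM n) := by
  simp [IntegrableSM, SignedMeasure.totalVariation_zero]

lemma integrableSM_toSigned_dirac (x : Fin n → ℝ) : IntegrableSM (toSigned (Measure.dirac x)) :=
  (isDiff_toSigned _).integrableSM
    (integrable_e2_iff.2 (by simp [lintegral_dirac' _ measurable_e2.ennreal_ofReal]))
    (integrable_zero_measure)

lemma IntegrableSM.sum {ι : Type*} {S : Finset ι} {μ : ι → SM n} {r : ι → ℝ}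
    (h : ∀ i ∈ S, IntegrableSM (μ i)) : IntegrableSM (∑ i ∈ S, r i • μ i) := by
  induction S using Finset.induction_on with
  | empty => simpa using integrableSM_zero
  | insert i S hi ih =>
    rw [Finset.sum_insert hi]
    exact ((h i (Finset.mem_insert_self _ _)).smul _).add
      (ih fun j hj => h j (Finset.mem_insert_of_mem hj))

lemma measurable_flipE (F : Finset (Fin n)) : Measurable (flipE F) := by
  refine measurable_pi_lambda _ fun i => ?_
  unfold flipE
  split_ifs <;> fun_prop

lemma measurable_projE (E : Finset (Fin n)) : Measurable (projE E) := by
  refine measurable_pi_lambda _ fun i => ?_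
  unfold projE
  split_ifs <;> fun_prop

lemma measurableSet_setA (E : Finset (Fin n)) : MeasurableSet (setA E) := by
  have : setA E = ⋂ i, {x : Fin n → ℝ | x i ≠ 0 ↔ i ∈ E} := by
    ext x
    simp [setA]
  rw [this]
  refine MeasurableSet.iInter fun i => ?_
  by_cases hi : i ∈ E
  · simp only [hi, iff_true]
    exact (measurableSet_eq_fun (measurable_pi_apply i) measurable_const).compl
  · simp only [hi, iff_false, not_not]
    exact measurableSet_eq_fun (measurable_pi_apply i) measurable_const

end Moment

section Mellin

variable {n : ℕ}

/-- The multiplicative character `∏_{i ∈ J} sign xᵢ ∏_{i ∈ E} |xᵢ|^{sᵢ}`, extended by zero. -/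
def mellinChar (E J : Finset (Fin n)) (s : Fin n → ℂ) (x : Fin n → ℝ) : ℂ :=
  ∏ i ∈ E, (((if i ∈ J then Real.sign (x i) else 1 : ℝ) : ℂ) * ((|x i| : ℝ) : ℂ) ^ s i)

/-- Exponents for which every Mellin character is bounded by `1 + ‖x‖₂`. -/
def mellinTube (n : ℕ) : Set (Fin n → ℂ) := {s | ∀ i, 0 < (s i).re ∧ (s i).re < (n : ℝ)⁻¹}

lemma ne_zero_of_mem_mellinTube {s : Fin n → ℂ} (hs : s ∈ mellinTube n) (i : Fin n) :
    s i ≠ 0 := fun h => by simpa [h] using (hs i).1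

lemma real_sign_mul (x y : ℝ) : Real.sign (x * y) = Real.sign x * Real.sign y := by
  rcases lt_trichotomy x 0 with hx | rfl | hx <;> rcases lt_trichotomy y 0 with hy | rfl | hy <;>
    simp [Real.sign_of_neg, Real.sign_of_pos, *, mul_pos_of_neg_of_neg, mul_neg_of_neg_of_pos,
      mul_neg_of_pos_of_neg]

lemma measurable_real_sign : Measurable Real.sign :=
  Measurable.ite measurableSet_Iio measurable_const
    (Measurable.ite measurableSet_Ioi measurable_const measurable_const)

lemma abs_real_sign_le (x : ℝ) : |Real.sign x| ≤ 1 := by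
  rcases Real.sign_apply_eq x with h | h | h <;> simp [h]

lemma mellinChar_mul (E J : Finset (Fin n)) (s : Fin n → ℂ) (x y : Fin n → ℝ) :
    mellinChar E J s (x * y) = mellinChar E J s x * mellinChar E J s y := by
  unfold mellinChar
  rw [← Finset.prod_mul_distrib]
  refine Finset.prod_congr rfl fun i _ => ?_
  rw [Pi.mul_apply, abs_mul, Complex.ofReal_mul,
    Complex.mul_cpow_ofReal_nonneg (abs_nonneg _) (abs_nonneg _), real_sign_mul]
  split_ifs
  · push_cast
    ring
  · simp

lemma mellinChar_eq_zero {E : Finset (Fin n)} (J : Finset (Fin n)) {s : Fin n → ℂ}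
    (hs : s ∈ mellinTube n) {x : Fin n → ℝ} {i : Fin n} (hi : i ∈ E) (hx : x i = 0) :
    mellinChar E J s x = 0 :=
  Finset.prod_eq_zero hi (by simp [hx, Complex.zero_cpow (ne_zero_of_mem_mellinTube hs i)])

lemma mellinChar_congr {E : Finset (Fin n)} (J : Finset (Fin n)) (s : Fin n → ℂ)
    {x y : Fin n → ℝ} (h : ∀ i ∈ E, x i = y i) : mellinChar E J s x = mellinChar E J s y :=
  Finset.prod_congr rfl fun i hi => by rw [h i hi]

lemma measurable_mellinChar (E J : Finset (Fin n)) (s : Fin n → ℂ) :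
    Measurable (mellinChar E J s) := by
  refine Finset.measurable_fun_prod _ fun i _ => Measurable.mul ?_ ?_
  · split_ifs
    · exact Complex.measurable_ofReal.comp (measurable_real_sign.comp (measurable_pi_apply i))
    · exact measurable_const
  · fun_prop

lemma norm_mellinChar_le (E J : Finset (Fin n)) {s : Fin n → ℂ} (hs : s ∈ mellinTube n)
    (x : Fin n → ℝ) : ‖mellinChar E J s x‖ ≤ 1 + e2 x := by
  have h1 : 1 ≤ 1 + e2 x := le_add_of_nonneg_right (e2_nonneg x)
  have h0 : 0 < 1 + e2 x := zero_lt_one.trans_le h1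
  calc ‖mellinChar E J s x‖
      ≤ ∏ i ∈ E, (1 + e2 x) ^ (s i).re := by
        rw [mellinChar, norm_prod]
        refine Finset.prod_le_prod (fun _ _ => norm_nonneg _) fun i _ => ?_
        rw [norm_mul, Complex.norm_real,
          Complex.norm_cpow_eq_rpow_re_of_nonneg (abs_nonneg _) (hs i).1.ne']
        have hsg : ‖(if i ∈ J then Real.sign (x i) else 1 : ℝ)‖ ≤ 1 := by
          split_ifs
          · exact abs_real_sign_le _
          · simp
        calc _ ≤ 1 * |x i| ^ (s i).re :=
              mul_le_mul_of_nonneg_right hsg (Real.rpow_nonneg (abs_nonneg _) _)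
          _ ≤ (1 + e2 x) ^ (s i).re := by
              rw [one_mul]
              exact Real.rpow_le_rpow (abs_nonneg _) (by linarith [abs_le_e2 x i]) (hs i).1.le
    _ = (1 + e2 x) ^ ∑ i ∈ E, (s i).re := (Real.rpow_sum_of_pos h0 _ _).symm
    _ ≤ (1 + e2 x) ^ (1 : ℝ) := by
        refine Real.rpow_le_rpow_of_exponent_le h1 ?_
        calc ∑ i ∈ E, (s i).re ≤ ∑ i ∈ E, (n : ℝ)⁻¹ := Finset.sum_le_sum fun i _ => (hs i).2.le
          _ = E.card * (n : ℝ)⁻¹ := by rw [Finset.sum_const, nsmul_eq_mul]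
          _ ≤ n * (n : ℝ)⁻¹ := by
              gcongr
              simpa using Finset.card_le_univ E
          _ ≤ 1 := mul_inv_le_one
    _ = 1 + e2 x := Real.rpow_one _

lemma integrable_mellinChar (E J : Finset (Fin n)) {s : Fin n → ℂ} (hs : s ∈ mellinTube n)
    {m : Measure (Fin n → ℝ)} [IsFiniteMeasure m] (hm : Integrable e2 m) :
    Integrable (mellinChar E J s) m :=
  ((integrable_const (1 : ℝ)).add hm).mono' (measurable_mellinChar E J s).aestronglyMeasurable
    (.of_forall fun x => norm_mellinChar_le E J hs x)

/-- The Mellin transform of a signed measure. -/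
def mellinSM (E J : Finset (Fin n)) (s : Fin n → ℂ) (μ : SM n) : ℂ := cInt μ (mellinChar E J s)

variable (E J : Finset (Fin n)) {s : Fin n → ℂ}

lemma IsDiff.mellinSM_eq (hs : s ∈ mellinTube n) {μ : SM n} {a b : Measure (Fin n → ℝ)}
    [IsFiniteMeasure a] [IsFiniteMeasure b] (h : IsDiff μ a b) (ha : Integrable e2 a)
    (hb : Integrable e2 b) :
    mellinSM E J s μ = (∫ x, mellinChar E J s x ∂a) - ∫ x, mellinChar E J s x ∂b :=
  h.cInt_eq (integrable_mellinChar E J hs ha) (integrable_mellinChar E J hs hb)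

lemma mellinSM_zero : mellinSM E J s 0 = 0 := by
  simp [mellinSM, cInt, SignedMeasure.toJordanDecomposition_zero]

lemma mellinSM_add (hs : s ∈ mellinTube n) {μ ν : SM n} (hμ : IntegrableSM μ)
    (hν : IntegrableSM ν) : mellinSM E J s (μ + ν) = mellinSM E J s μ + mellinSM E J s ν := by
  rw [((isDiff_jordan μ).add (isDiff_jordan ν)).mellinSM_eq E J hs
      (hμ.posPart.add_measure hν.posPart) (hμ.negPart.add_measure hν.negPart),
    integral_add_measure (integrable_mellinChar E J hs hμ.posPart)
      (integrable_mellinChar E J hs hν.posPart),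
    integral_add_measure (integrable_mellinChar E J hs hμ.negPart)
      (integrable_mellinChar E J hs hν.negPart), mellinSM, mellinSM, cInt, cInt]
  ring

lemma mellinSM_neg (hs : s ∈ mellinTube n) {μ : SM n} (hμ : IntegrableSM μ) :
    mellinSM E J s (-μ) = -mellinSM E J s μ := by
  rw [(isDiff_jordan μ).neg.mellinSM_eq E J hs hμ.negPart hμ.posPart, mellinSM, cInt, neg_sub]

lemma mellinSM_smul (hs : s ∈ mellinTube n) {μ : SM n} (hμ : IntegrableSM μ) (r : ℝ) :
    mellinSM E J s (r • μ) = r * mellinSM E J s μ := by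
  have key (t : NNReal) : mellinSM E J s ((t : ℝ) • μ) = (t : ℝ) * mellinSM E J s μ := by
    rw [((isDiff_jordan μ).smul_nnreal t).mellinSM_eq E J hs hμ.posPart.smul_measure_nnreal
      hμ.negPart.smul_measure_nnreal, integral_smul_nnreal_measure, integral_smul_nnreal_measure,
      mellinSM, cInt, NNReal.smul_def, NNReal.smul_def, Complex.real_smul, Complex.real_smul,
      mul_sub]
  rcases le_total 0 r with h | h
  · simpa only [Real.coe_toNNReal r h] using key r.toNNReal
  · have hr : r • μ = -((-r) • μ) := by
      ext A hA
      simp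
    rw [hr, mellinSM_neg E J hs (hμ.smul _)]
    have := key (-r).toNNReal
    rw [Real.coe_toNNReal _ (neg_nonneg.2 h)] at this
    rw [this]
    push_cast
    ring

lemma mellinSM_sum (hs : s ∈ mellinTube n) {ι : Type*} {S : Finset ι} {μ : ι → SM n}
    {r : ι → ℝ} (h : ∀ i ∈ S, IntegrableSM (μ i)) :
    mellinSM E J s (∑ i ∈ S, r i • μ i) = ∑ i ∈ S, (r i : ℂ) * mellinSM E J s (μ i) := by
  induction S using Finset.induction_on with
  | empty => simpa using mellinSM_zero E J
  | insert i S hi ih =>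
    have hS : ∀ j ∈ S, IntegrableSM (μ j) := fun j hj => h j (Finset.mem_insert_of_mem hj)
    rw [Finset.sum_insert hi, Finset.sum_insert hi, mellinSM_add E J hs
      ((h i (Finset.mem_insert_self _ _)).smul _) (.sum hS),
      mellinSM_smul E J hs (h i (Finset.mem_insert_self _ _)), ih hS]

lemma mellinSM_toSigned_dirac (hs : s ∈ mellinTube n) (x : Fin n → ℝ) :
    mellinSM E J s (toSigned (Measure.dirac x)) = mellinChar E J s x := by
  rw [(isDiff_toSigned (Measure.dirac x)).mellinSM_eq E J hs
    (integrable_e2_iff.2 (by simp [lintegral_dirac' _ measurable_e2.ennreal_ofReal]))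
    integrable_zero_measure, integral_zero_measure, sub_zero,
    integral_dirac' _ _ (measurable_mellinChar E J s).stronglyMeasurable]

lemma mellinSM_mconv (hs : s ∈ mellinTube n) {μ ν : SM n} (hμ : IntegrableSM μ)
    (hν : IntegrableSM ν) :
    mellinSM E J s (mconv μ ν) = mellinSM E J s μ * mellinSM E J s ν := by
  have hm : Measurable fun p : (Fin n → ℝ) × (Fin n → ℝ) => p.1 * p.2 := by fun_prop
  have key (a b : Measure (Fin n → ℝ)) [IsFiniteMeasure a] [IsFiniteMeasure b] :
      ∫ x, mellinChar E J s x ∂(mconvPos a b)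
        = (∫ x, mellinChar E J s x ∂a) * ∫ x, mellinChar E J s x ∂b := by
    rw [mconvPos, integral_map hm.aemeasurable
      (measurable_mellinChar E J s).aestronglyMeasurable, ← integral_prod_mul]
    simp only [mellinChar_mul]
  have I {a b : Measure (Fin n → ℝ)} [IsFiniteMeasure a] [IsFiniteMeasure b]
      (ha : Integrable e2 a) (hb : Integrable e2 b) :=
    integrable_mellinChar E J hs (integrable_e2_mconvPos ha hb)
  rw [(isDiff_mconv μ ν).mellinSM_eq E J hs
    ((integrable_e2_mconvPos hμ.posPart hν.posPart).add_measure
      (integrable_e2_mconvPos hμ.negPart hν.negPart))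
    ((integrable_e2_mconvPos hμ.posPart hν.negPart).add_measure
      (integrable_e2_mconvPos hμ.negPart hν.posPart)),
    integral_add_measure (I hμ.posPart hν.posPart) (I hμ.negPart hν.negPart),
    integral_add_measure (I hμ.posPart hν.negPart) (I hμ.negPart hν.posPart),
    key, key, key, key, mellinSM, mellinSM, cInt, cInt]
  ring

lemma mellinSM_map (hs : s ∈ mellinTube n) {μ : SM n} (hμ : IntegrableSM μ)
    {g : (Fin n → ℝ) → Fin n → ℝ} (hg : Measurable g) (hle : ∀ x, e2 (g x) ≤ e2 x) {c : ℂ}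
    (hc : ∀ x, mellinChar E J s (g x) = c * mellinChar E J s x) :
    mellinSM E J s (μ.map g) = c * mellinSM E J s μ := by
  have hm := (measurable_mellinChar E J s).aestronglyMeasurable
    (μ := μ.toJordanDecomposition.posPart.map g)
  have hm' := (measurable_mellinChar E J s).aestronglyMeasurable
    (μ := μ.toJordanDecomposition.negPart.map g)
  rw [((isDiff_jordan μ).map hg).mellinSM_eq E J hs (integrable_e2_map hμ.posPart hg hle)
    (integrable_e2_map hμ.negPart hg hle), integral_map hg.aemeasurable hm,
    integral_map hg.aemeasurable hm', mellinSM, cInt]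
  simp only [hc, integral_const_mul]
  ring

lemma mellinSM_restrict (hs : s ∈ mellinTube n) {μ : SM n} (hμ : IntegrableSM μ)
    {S : Set (Fin n → ℝ)} (hS : MeasurableSet S)
    (h0 : ∀ᵐ x ∂μ.totalVariation, x ∉ S → mellinChar E J s x = 0) :
    mellinSM E J s (μ.restrict S) = mellinSM E J s μ := by
  rw [SignedMeasure.totalVariation, ae_add_measure_iff] at h0
  rw [((isDiff_jordan μ).restrict hS).mellinSM_eq E J hs hμ.posPart.restrict hμ.negPart.restrict,
    setIntegral_eq_integral_of_ae_compl_eq_zero h0.1,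
    setIntegral_eq_integral_of_ae_compl_eq_zero h0.2, mellinSM, cInt]

lemma mellinChar_flipE {E J : Finset (Fin n)} (hJ : J ⊆ E) (F : Finset (Fin n)) (s : Fin n → ℂ)
    (x : Fin n → ℝ) :
    mellinChar E J s (flipE F x) = (-1) ^ (J ∩ F).card * mellinChar E J s x := by
  have hsub : E ∩ (J ∩ F) = J ∩ F := Finset.inter_eq_right.2 (Finset.inter_subset_left.trans hJ)
  have h1 : ((-1 : ℂ)) ^ (J ∩ F).card = ∏ i ∈ E, if i ∈ J ∩ F then -1 else 1 := by
    rw [← Finset.prod_filter, Finset.filter_mem_eq_inter, hsub, Finset.prod_const]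
  rw [h1, mellinChar, mellinChar, ← Finset.prod_mul_distrib]
  refine Finset.prod_congr rfl fun i _ => ?_
  by_cases hiJ : i ∈ J <;> by_cases hiF : i ∈ F <;>
    simp [flipE, hiJ, hiF, Real.sign_neg]

end Mellin

section Holomorphy

open Metric Filter Topology

lemma differentiableOn_integral_of_dominated {Ω : Type*} [MeasurableSpace Ω] {m : Measure Ω}
    {f : ℂ → Ω → ℂ} {U : Set ℂ} (hU : IsOpen U) {bound : Ω → ℝ}
    (hf : ∀ ω, DifferentiableOn ℂ (fun z => f z ω) U)
    (hmeas : ∀ z ∈ U, AEStronglyMeasurable (f z) m) (hbound : Integrable bound m)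
    (hle : ∀ z ∈ U, ∀ ω, ‖f z ω‖ ≤ bound ω) :
    DifferentiableOn ℂ (fun z => ∫ ω, f z ω ∂m) U := by
  intro z₀ hz₀
  obtain ⟨R, hR, hRU⟩ := Metric.isOpen_iff.1 hU z₀ hz₀
  have hderiv : ∀ ω, ∀ z ∈ U, HasDerivAt (fun z => f z ω) (deriv (fun z => f z ω) z) z :=
    fun ω z hz => ((hf ω).differentiableAt (hU.mem_nhds hz)).hasDerivAt
  have hsub : ∀ z ∈ ball z₀ (R / 2), closedBall z (R / 4) ⊆ U := fun z hz y hy => hRU <| by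
    have := dist_triangle y z z₀
    rw [mem_ball] at *
    rw [mem_closedBall] at hy
    linarith
  have hD : AEStronglyMeasurable (fun ω => deriv (fun z => f z ω) z₀) m := by
    let u : ℕ → ℂ := fun k => z₀ + ((R / 2 / (k + 1 : ℝ) : ℝ) : ℂ)
    have hpos (k : ℕ) : 0 < R / 2 / (k + 1 : ℝ) := by positivity
    have huU (k : ℕ) : u k ∈ U := hRU <| by
      simp only [u, mem_ball, dist_eq_norm, add_sub_cancel_left, Complex.norm_real,
        Real.norm_of_nonneg (hpos k).le]
      calc R / 2 / (k + 1 : ℝ) ≤ R / 2 := div_le_self (by positivity) (by simp)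
        _ < R := by linarith
    have hu : Tendsto u atTop (𝓝[≠] z₀) := by
      refine tendsto_nhdsWithin_iff.2 ⟨?_, .of_forall fun k => ?_⟩
      · have h0 : Tendsto (fun k : ℕ => R / 2 / (k + 1 : ℝ)) atTop (𝓝 0) :=
          tendsto_const_nhds.div_atTop
            (tendsto_natCast_atTop_atTop.atTop_add tendsto_const_nhds)
        have := ((Complex.continuous_ofReal.tendsto 0).comp h0).const_add z₀
        simpa [u, Function.comp_def] using this
      · simp only [u, Set.mem_compl_iff, Set.mem_singleton_iff, add_eq_left,
          Complex.ofReal_eq_zero]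
        exact (hpos k).ne'
    refine aestronglyMeasurable_of_tendsto_ae atTop
      (f := fun k ω => slope (fun z => f z ω) z₀ (u k)) (fun k => ?_) (.of_forall fun ω => ?_)
    · simp only [slope, vsub_eq_sub]
      exact ((hmeas _ (huU k)).sub (hmeas _ hz₀)).const_smul (u k - z₀)⁻¹
    · exact (hasDerivAt_iff_tendsto_slope.1 (hderiv ω z₀ hz₀)).comp hu
  have hb : ∀ ω, ∀ z ∈ ball z₀ (R / 2),
      ‖deriv (fun z => f z ω) z‖ ≤ bound ω / (R / 4) := fun ω z hz => by
    refine Complex.norm_deriv_le_of_forall_mem_sphere_norm_le (by positivity)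
      (((hf ω).mono (closure_ball_subset_closedBall.trans (hsub z hz))).diffContOnCl) fun y hy =>
        hle y (hsub z hz (sphere_subset_closedBall hy)) ω
  refine (hasDerivAt_integral_of_dominated_loc_of_deriv_le
    (F := f) (F' := fun z ω => deriv (fun z => f z ω) z) (s := ball z₀ (R / 2))
    (ball_mem_nhds z₀ (by positivity))
    (Filter.eventually_of_mem (hU.mem_nhds hz₀) hmeas)
    (hbound.mono' (hmeas z₀ hz₀) (.of_forall (hle z₀ hz₀))) hD
    (.of_forall hb) (hbound.div_const _)
    (.of_forall fun ω z hz => hderiv ω z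
      (hsub z hz (mem_closedBall_self (by positivity))))).2.differentiableAt.differentiableWithinAt

variable {n : ℕ}

lemma isOpen_mellinTube : IsOpen (mellinTube n) := by
  have : mellinTube n = ⋂ i, {s | 0 < (s i).re ∧ (s i).re < (n : ℝ)⁻¹} := by
    ext s
    simp [mellinTube]
  rw [this]
  refine isOpen_iInter_of_finite fun i => ?_
  have hre : Continuous fun s : Fin n → ℂ => (s i).re := by fun_prop
  exact (isOpen_lt continuous_const hre).inter (isOpen_lt hre continuous_const)

lemma convex_mellinTube : Convex ℝ (mellinTube n) := by
  intro s hs t ht a b ha hb hab i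
  have := convex_Ioo (0 : ℝ) (n : ℝ)⁻¹ (hs i) (ht i) ha hb hab
  simpa using this

lemma differentiableOn_mellinSM_line (E J : Finset (Fin n)) {μ : SM n} (hμ : IntegrableSM μ)
    (s v : Fin n → ℂ) :
    DifferentiableOn ℂ (fun z : ℂ => mellinSM E J (s + z • v) μ)
      {z | s + z • v ∈ mellinTube n} := by
  have hU : IsOpen {z : ℂ | s + z • v ∈ mellinTube n} :=
    isOpen_mellinTube.preimage (by fun_prop)
  have key (m : Measure (Fin n → ℝ)) [IsFiniteMeasure m] (hm : Integrable e2 m) :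
      DifferentiableOn ℂ (fun z : ℂ => ∫ x, mellinChar E J (s + z • v) x ∂m)
        {z | s + z • v ∈ mellinTube n} := by
    refine differentiableOn_integral_of_dominated hU (fun x z hz => ?_)
      (fun z _ => (measurable_mellinChar E J _).aestronglyMeasurable)
      ((integrable_const (1 : ℝ)).add hm) (fun z hz x => norm_mellinChar_le E J hz x)
    refine DifferentiableAt.differentiableWithinAt ?_
    unfold mellinChar
    refine DifferentiableAt.fun_finsetProd fun i _ => DifferentiableAt.const_mul ?_ _
    refine DifferentiableAt.const_cpow ?_ (.inr (ne_zero_of_mem_mellinTube hz i))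
    simp only [Pi.add_apply, Pi.smul_apply, smul_eq_mul]
    fun_prop
  exact (key _ hμ.posPart).sub (key _ hμ.negPart)

/-- If the product of two Mellin transforms vanishes, one of the factors vanishes. -/
lemma mellinSM_eq_zero_or_eq_zero (E J : Finset (Fin n)) {μ ν : SM n} (hμ : IntegrableSM μ)
    (hν : IntegrableSM ν)
    (h : ∀ s ∈ mellinTube n, mellinSM E J s μ * mellinSM E J s ν = 0) :
    (∀ s ∈ mellinTube n, mellinSM E J s μ = 0) ∨ ∀ s ∈ mellinTube n, mellinSM E J s ν = 0 := by
  by_contra! hne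
  obtain ⟨⟨s, hs, hμs⟩, ⟨t, ht, hνt⟩⟩ := hne
  set U : Set ℂ := {z | s + z • (t - s) ∈ mellinTube n}
  have hU : IsOpen U := isOpen_mellinTube.preimage (by fun_prop)
  have hconv : Convex ℝ U := by
    intro z hz w hw a b ha hb hab
    have := convex_mellinTube hz hw ha hb hab
    have heq : s + (a • z + b • w) • (t - s)
        = a • (s + z • (t - s)) + b • (s + w • (t - s)) := by
      have hs' : s = (a + b) • s := by rw [hab, one_smul]
      ext i
      have := congrFun hs' i
      simp only [Pi.add_apply, Pi.smul_apply, Complex.real_smul, smul_eq_mul, Pi.sub_apply,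
        Complex.ofReal_add] at this ⊢
      linear_combination this
    simpa only [U, Set.mem_ofPred_eq, heq] using this
  have h0 : (0 : ℂ) ∈ U := by simpa [U] using hs
  have h1 : (1 : ℂ) ∈ U := by simpa [U] using ht
  rcases AnalyticOnNhd.eq_zero_or_eq_zero_of_mul_eq_zero
    ((differentiableOn_mellinSM_line E J hμ s (t - s)).analyticOnNhd hU)
    ((differentiableOn_mellinSM_line E J hν s (t - s)).analyticOnNhd hU)
    (fun z hz => h _ hz) hconv.isPreconnected with h' | h'
  · exact hμs (by simpa using h' 0 h0)
  · exact hνt (by simpa using h' 1 h1)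

end Holomorphy

section Concentration

variable {n : ℕ}

lemma concOn_of_restrict_compl {μ : SM n} {A : Set (Fin n → ℝ)} (hA : MeasurableSet A)
    (h : μ.restrict Aᶜ = 0) : ConcOn μ A :=
  totalVariation_eq_zero_of_forall hA.compl h

lemma ConcOn.mono {μ : SM n} {A B : Set (Fin n → ℝ)} (h : ConcOn μ A) (hAB : A ⊆ B) :
    ConcOn μ B :=
  measure_mono_null (Set.compl_subset_compl.2 hAB) h

lemma concOn_restrict (μ : SM n) {A : Set (Fin n → ℝ)} (hA : MeasurableSet A) :
    ConcOn (μ.restrict A) A := by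
  refine le_antisymm ?_ zero_le
  have := ((isDiff_jordan μ).restrict hA).totalVariation_le Aᶜ
  simpa [Measure.restrict_apply hA.compl] using this

lemma ConcOn.mconv {μ ν : SM n} {A B C : Set (Fin n → ℝ)} (hμ : ConcOn μ A) (hν : ConcOn ν B)
    (hC : MeasurableSet C) (h : ∀ x ∈ A, ∀ y ∈ B, x * y ∈ C) : ConcOn (mconv μ ν) C := by
  have key (a b : Measure (Fin n → ℝ)) [IsFiniteMeasure a] [IsFiniteMeasure b] (ha : a Aᶜ = 0)
      (hb : b Bᶜ = 0) : mconvPos a b Cᶜ = 0 := by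
    have hm : Measurable fun p : (Fin n → ℝ) × (Fin n → ℝ) => p.1 * p.2 := by fun_prop
    rw [mconvPos, Measure.map_apply hm hC.compl]
    refine measure_mono_null (t := Aᶜ ×ˢ Set.univ ∪ Set.univ ×ˢ Bᶜ) (fun p hp => ?_)
      (measure_union_null (by simp [Measure.prod_prod, ha]) (by simp [Measure.prod_prod, hb]))
    by_contra hn
    simp only [Set.mem_union, Set.mem_prod, Set.mem_compl_iff, Set.mem_univ, and_true, true_and,
      not_or, not_not] at hn
    exact hp (h _ hn.1 _ hn.2)
  obtain ⟨hμp, hμq⟩ := add_eq_zero.1 hμ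
  obtain ⟨hνp, hνq⟩ := add_eq_zero.1 hν
  refine le_antisymm (((isDiff_mconv μ ν).totalVariation_le Cᶜ).trans_eq ?_) zero_le
  simp only [Measure.add_apply]
  simp [key _ _ hμp hνp, key _ _ hμq hνq, key _ _ hμp hνq, key _ _ hμq hνp]

lemma mul_mem_setA {E : Finset (Fin n)} {x y : Fin n → ℝ} (hx : x ∈ setA Finset.univ)
    (hy : y ∈ setA E) : x * y ∈ setA E := fun i => by
  rw [Pi.mul_apply, mul_ne_zero_iff, hy i]
  exact and_iff_right ((hx i).2 (Finset.mem_univ i))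

lemma eq_of_mem_setA {E F : Finset (Fin n)} {x : Fin n → ℝ} (hE : x ∈ setA E)
    (hF : x ∈ setA F) : E = F :=
  Finset.ext fun i => (hE i).symm.trans (hF i)

end Concentration

section Uniqueness

variable {n : ℕ}

/-- Logarithms of the absolute values together with the signs of the coordinates. -/
def logSign (x : Fin n → ℝ) : Fin n ⊕ Fin n → ℝ :=
  Sum.elim (fun i => Real.log (x i)) (fun i => Real.sign (x i))

lemma measurable_logSign : Measurable (logSign : (Fin n → ℝ) → Fin n ⊕ Fin n → ℝ) := by
  refine measurable_pi_lambda _ fun k => ?_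
  rcases k with i | i
  · exact Real.measurable_log.comp (measurable_pi_apply i)
  · exact measurable_real_sign.comp (measurable_pi_apply i)

/-- A left inverse of `logSign`. -/
def expSign (y : Fin n ⊕ Fin n → ℝ) : Fin n → ℝ :=
  fun i => y (Sum.inr i) * Real.exp (y (Sum.inl i))

lemma measurable_expSign : Measurable (expSign : (Fin n ⊕ Fin n → ℝ) → Fin n → ℝ) := by
  unfold expSign
  fun_prop

lemma expSign_logSign (x : Fin n → ℝ) : expSign (logSign x) = x := by
  ext i
  rcases lt_trichotomy (x i) 0 with h | h | h
  · simp [expSign, logSign, Real.exp_log_of_neg h, Real.sign_of_neg h]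
  · simp [expSign, logSign, h]
  · simp [expSign, logSign, Real.exp_log h, Real.sign_of_pos h]

lemma map_logSign_injective {a b : Measure (Fin n → ℝ)}
    (h : a.map logSign = b.map logSign) : a = b := by
  have key (m : Measure (Fin n → ℝ)) : (m.map logSign).map expSign = m := by
    rw [Measure.map_map measurable_expSign measurable_logSign]
    convert Measure.map_id
    exact funext expSign_logSign
  rw [← key a, h, key b]

lemma exp_sign_mul_I {x : ℝ} (hx : x ≠ 0) (u : ℝ) :
    Complex.exp ((Real.sign x * u : ℝ) * Complex.I)
      = Real.sign x * (Complex.sin u * Complex.I) + Complex.cos u := by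
  rcases Real.sign_apply_eq_of_ne_zero x hx with h | h
  · rw [h, Complex.exp_mul_I]
    push_cast
    rw [neg_one_mul, Complex.sin_neg, Complex.cos_neg]
    ring
  · rw [h, one_mul, Complex.exp_mul_I]
    push_cast
    ring

lemma exp_dual_logSign {E : Finset (Fin n)} {x : Fin n → ℝ} (hx : x ∈ setA E)
    (L : StrongDual ℝ (Fin n ⊕ Fin n → ℝ)) (c : ℝ) :
    ((∏ i ∈ E, |x i| ^ c : ℝ) : ℂ) * Complex.exp (L (logSign x) * Complex.I)
      = ∑ J ∈ E.powerset,
        ((∏ i ∈ J, Complex.sin (L (Pi.single (Sum.inr i) 1)) * Complex.I)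
            * ∏ i ∈ E \ J, Complex.cos (L (Pi.single (Sum.inr i) 1)))
          * mellinChar E J (fun i => c + L (Pi.single (Sum.inl i) 1) * Complex.I) x := by
  have hL : L (logSign x) = ∑ i ∈ E, (Real.log (x i) * L (Pi.single (Sum.inl i) 1)
      + Real.sign (x i) * L (Pi.single (Sum.inr i) 1)) := by
    have h1 := LinearMap.pi_apply_eq_sum_univ (L : (Fin n ⊕ Fin n → ℝ) →ₗ[ℝ] ℝ) (logSign x)
    have h2 : ∀ k : Fin n ⊕ Fin n, (fun j => if k = j then (1 : ℝ) else 0) = Pi.single k 1 :=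
      fun k => by
        ext j
        simp [Pi.single_apply, eq_comm]
    simp only [h2, ContinuousLinearMap.coe_coe, Fintype.sum_sum_type, smul_eq_mul] at h1
    rw [h1, ← Finset.sum_add_distrib]
    symm
    refine Finset.sum_subset (Finset.subset_univ E) fun i _ hi => ?_
    have : x i = 0 := by
      by_contra h0
      exact hi ((hx i).1 h0)
    simp [this]
  have hA : ∀ i ∈ E, ((|x i| : ℝ) : ℂ) ^ ((c : ℂ) + L (Pi.single (Sum.inl i) 1) * Complex.I)
      = ((|x i| ^ c : ℝ) : ℂ)
        * Complex.exp ((Real.log (x i) * L (Pi.single (Sum.inl i) 1) : ℝ) * Complex.I) := by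
    intro i hi
    have h0 : 0 < |x i| := abs_pos.2 ((hx i).2 hi)
    have h0' : ((|x i| : ℝ) : ℂ) ≠ 0 := Complex.ofReal_ne_zero.2 h0.ne'
    rw [Complex.cpow_add _ _ h0', ← Complex.ofReal_cpow h0.le, Complex.cpow_def_of_ne_zero h0',
      ← Complex.ofReal_log h0.le, Real.log_abs]
    congr 2
    push_cast
    ring
  have hprod : ∀ J ∈ E.powerset,
      ((∏ i ∈ J, Complex.sin (L (Pi.single (Sum.inr i) 1)) * Complex.I)
          * ∏ i ∈ E \ J, Complex.cos (L (Pi.single (Sum.inr i) 1)))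
        * mellinChar E J (fun i => c + L (Pi.single (Sum.inl i) 1) * Complex.I) x
      = (∏ i ∈ J, ((|x i| : ℝ) : ℂ) ^ ((c : ℂ) + L (Pi.single (Sum.inl i) 1) * Complex.I)
          * (Real.sign (x i) * (Complex.sin (L (Pi.single (Sum.inr i) 1)) * Complex.I)))
        * ∏ i ∈ E \ J, ((|x i| : ℝ) : ℂ) ^ ((c : ℂ) + L (Pi.single (Sum.inl i) 1) * Complex.I)
          * Complex.cos (L (Pi.single (Sum.inr i) 1)) := by
    intro J hJ
    rw [mellinChar, ← Finset.prod_sdiff (Finset.mem_powerset.1 hJ),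
      mul_comm (∏ i ∈ E \ J, (_ * _)) (∏ i ∈ J, _), mul_mul_mul_comm, ← Finset.prod_mul_distrib,
      ← Finset.prod_mul_distrib]
    congr 1
    · refine Finset.prod_congr rfl fun i hi => ?_
      rw [if_pos hi]
      ring
    · refine Finset.prod_congr rfl fun i hi => ?_
      rw [if_neg (Finset.mem_sdiff.1 hi).2, Complex.ofReal_one]
      ring
  rw [Finset.sum_congr rfl hprod, ← Finset.prod_add, hL, Complex.ofReal_sum, Finset.sum_mul,
    Complex.exp_sum, Complex.ofReal_prod, ← Finset.prod_mul_distrib]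
  refine Finset.prod_congr rfl fun i hi => ?_
  rw [← mul_add, ← exp_sign_mul_I ((hx i).2 hi), hA i hi, mul_assoc, ← Complex.exp_add]
  congr 2
  push_cast
  ring

/-- A signed measure on `setA E` is determined by its Mellin transform. -/
lemma eq_zero_of_mellinSM_eq_zero {E : Finset (Fin n)} {μ : SM n} (hμ : IntegrableSM μ)
    (hE : ConcOn μ (setA E))
    (h : ∀ J ⊆ E, ∀ s ∈ mellinTube n, mellinSM E J s μ = 0) : μ = 0 := by
  set c : ℝ := (n : ℝ)⁻¹ / 2 with hc
  have hw0 (x : Fin n → ℝ) : 0 ≤ ∏ i ∈ E, |x i| ^ c :=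
    Finset.prod_nonneg fun i _ => Real.rpow_nonneg (abs_nonneg _) _
  have hvm : Measurable fun x : Fin n → ℝ => ∏ i ∈ E, |x i| ^ c :=
    Finset.measurable_fun_prod _ fun i _ => (measurable_pi_apply i).abs.pow_const c
  obtain ⟨w, hwm, hw⟩ : ∃ w : (Fin n → ℝ) → NNReal, Measurable w ∧
      ∀ x, (w x : ℝ) = ∏ i ∈ E, |x i| ^ c :=
    ⟨_, hvm.real_toNNReal, fun x => Real.coe_toNNReal _ (hw0 x)⟩
  have htube (t : Fin n → ℝ) : (fun i => (c : ℂ) + t i * Complex.I) ∈ mellinTube n := by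
    intro i
    have hn : (0 : ℝ) < n := Nat.cast_pos.2 i.pos
    have : (0 : ℝ) < (n : ℝ)⁻¹ := inv_pos.2 hn
    have hre : ((c : ℂ) + t i * Complex.I).re = c := by simp
    rw [hre, hc]
    constructor <;> linarith
  have hwle (x : Fin n → ℝ) : ∏ i ∈ E, |x i| ^ c ≤ 1 + e2 x := by
    have := norm_mellinChar_le E ∅ (htube 0) x
    refine le_trans (le_of_eq ?_) this
    rw [mellinChar, norm_prod]
    refine Finset.prod_congr rfl fun i _ => ?_
    have hne : ((c : ℂ) + ((0 : Fin n → ℝ) i : ℝ) * Complex.I).re ≠ 0 := (htube 0 i).1.ne'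
    rw [norm_mul, Complex.norm_cpow_eq_rpow_re_of_nonneg (abs_nonneg _) hne]
    simp
  obtain ⟨hp, hq⟩ : (∀ᵐ x ∂μ.toJordanDecomposition.posPart, x ∈ setA E) ∧
      ∀ᵐ x ∂μ.toJordanDecomposition.negPart, x ∈ setA E := by
    rw [← ae_add_measure_iff]
    exact hE
  have hfin (m : Measure (Fin n → ℝ)) [IsFiniteMeasure m] (hm : Integrable e2 m) :
      IsFiniteMeasure (m.withDensity fun x => (w x : ℝ≥0∞)) := by
    have hi : Integrable (fun x => (w x : ℝ)) m :=
      ((integrable_const (1 : ℝ)).add hm).mono' hwm.coe_nnreal_real.aestronglyMeasurable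
        (.of_forall fun x => by
          rw [Real.norm_of_nonneg (w x).coe_nonneg, hw]
          exact hwle x)
    simpa using isFiniteMeasure_withDensity_ofReal hi.2
  have hchar (m : Measure (Fin n → ℝ)) [IsFiniteMeasure m] (hm : Integrable e2 m)
      (hmE : ∀ᵐ x ∂m, x ∈ setA E) (L : StrongDual ℝ (Fin n ⊕ Fin n → ℝ)) :
      charFunDual ((m.withDensity fun x => (w x : ℝ≥0∞)).map logSign) L
        = ∑ J ∈ E.powerset,
          ((∏ i ∈ J, Complex.sin (L (Pi.single (Sum.inr i) 1)) * Complex.I)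
              * ∏ i ∈ E \ J, Complex.cos (L (Pi.single (Sum.inr i) 1)))
            * ∫ x, mellinChar E J (fun i => c + L (Pi.single (Sum.inl i) 1) * Complex.I) x ∂m := by
    rw [charFunDual_apply, integral_map measurable_logSign.aemeasurable (by fun_prop),
      integral_withDensity_eq_integral_smul hwm]
    simp only [← integral_const_mul]
    rw [← integral_finsetSum _ fun J _ =>
      (integrable_mellinChar E J (htube _) hm).const_mul _]
    refine integral_congr_ae (hmE.mono fun x hx => ?_)
    simp only [← exp_dual_logSign hx L c]
    rw [NNReal.smul_def, hw, Complex.real_smul]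
  have := hfin _ hμ.posPart
  have := hfin _ hμ.negPart
  have hmap : (μ.toJordanDecomposition.posPart.withDensity fun x => (w x : ℝ≥0∞)).map logSign
      = (μ.toJordanDecomposition.negPart.withDensity fun x => (w x : ℝ≥0∞)).map logSign := by
    refine Measure.ext_of_charFunDual (funext fun L => ?_)
    rw [hchar _ hμ.posPart hp L, hchar _ hμ.negPart hq L]
    refine Finset.sum_congr rfl fun J hJ => ?_
    congr 1
    exact sub_eq_zero.1 (h J (Finset.mem_powerset.1 hJ) _ (htube _))
  have hd := map_logSign_injective hmap
  have hinv (m : Measure (Fin n → ℝ)) (hmE : ∀ᵐ x ∂m, x ∈ setA E) :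
      (m.withDensity fun x => (w x : ℝ≥0∞)).withDensity (fun x => (w x : ℝ≥0∞)⁻¹) = m := by
    refine withDensity_inv_same hwm.coe_nnreal_ennreal (hmE.mono fun x hx => ?_) (by simp)
    rw [Ne, ENNReal.coe_eq_zero, ← NNReal.coe_eq_zero, hw]
    refine ne_of_gt ?_
    exact Finset.prod_pos fun i hi => Real.rpow_pos_of_pos (abs_pos.2 ((hx i).2 hi)) _
  refine eq_zero_of_posPart_eq_negPart ?_
  rw [← hinv _ hp, hd, hinv _ hq]

/-- Global uniqueness, by descending induction over the supports. -/
lemma eq_zero_of_forall_mellinSM {μ : SM n} (hμ : IntegrableSM μ)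
    (h : ∀ E, μ.totalVariation (setA E) = 0 ∨
      ∀ J ⊆ E, ∀ s ∈ mellinTube n, mellinSM E J s μ = 0) : μ = 0 := by
  have key : ∀ E, μ.totalVariation (setA E) = 0 := by
    intro E
    induction E using WellFoundedGT.induction with
    | ind E ih =>
    rcases h E with h0 | h0
    · exact h0
    refine totalVariation_eq_zero_of_forall (measurableSet_setA E) ?_
    refine eq_zero_of_mellinSM_eq_zero (E := E) (hμ.restrict (measurableSet_setA E))
      (concOn_restrict μ (measurableSet_setA E)) fun J hJ s hs => ?_
    rw [mellinSM_restrict E J hs hμ (measurableSet_setA E), h0 J hJ s hs]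
    have hall : ∀ᵐ x ∂μ.totalVariation, ∀ E', E < E' → x ∉ setA E' :=
      ae_all_iff.2 fun E' => by
        by_cases hE' : E < E'
        · simpa [hE', ae_iff] using ih E' hE'
        · simp [hE']
    refine hall.mono fun x hx hxE => ?_
    by_contra hne
    have hsub : ∀ i ∈ E, x i ≠ 0 := fun i hi hi0 => hne (mellinChar_eq_zero J hs hi hi0)
    have hx' : x ∈ setA (Finset.univ.filter fun i => x i ≠ 0) := fun i => by simp
    have hle : E ≤ Finset.univ.filter fun i => x i ≠ 0 := fun i hi => by simp [hsub i hi]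
    rcases hle.lt_or_eq with hlt | heq
    · exact hx _ hlt hx'
    · exact hxE (heq ▸ hx')
  refine eq_zero_of_totalVariation_univ ?_
  have hcover : (Set.univ : Set (Fin n → ℝ)) = ⋃ E, setA E := by
    refine (Set.eq_univ_of_forall fun x => Set.mem_iUnion.2
      ⟨Finset.univ.filter fun i => x i ≠ 0, fun i => by simp⟩).symm
  rw [hcover]
  exact measure_iUnion_null key

end Uniqueness

section Atoms

variable {n : ℕ}

/-- The product signed measure whose `i`-th factor has mass `r i β` at the point `u i β`. -/
def atoms (r u : Fin n → Bool → ℝ) : SM n :=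
  ∑ b : Fin n → Bool, (∏ i, r i (b i)) • toSigned (Measure.dirac fun i => u i (b i))

lemma integrableSM_atoms (r u : Fin n → Bool → ℝ) : IntegrableSM (atoms r u) :=
  .sum fun _ _ => integrableSM_toSigned_dirac _

lemma concOn_atoms (r u : Fin n → Bool → ℝ) {E : Finset (Fin n)}
    (h : ∀ i β, u i β ≠ 0 ↔ i ∈ E) : ConcOn (atoms r u) (setA E) := by
  have hA := measurableSet_setA E
  refine concOn_of_restrict_compl hA (VectorMeasure.ext fun B hB => ?_)
  rw [VectorMeasure.restrict_apply _ hA.compl hB, _root_.zero_apply, atoms,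
    ← FunLike.coeAddMonoidHom_apply, map_sum, Finset.sum_apply]
  refine Finset.sum_eq_zero fun b _ => ?_
  have hmem : (fun i => u i (b i)) ∈ setA E := fun i => h i _
  rw [FunLike.coeAddMonoidHom_apply, _root_.smul_apply, toSigned_apply _ (hB.inter hA.compl),
    measureReal_def, Measure.dirac_apply' _ (hB.inter hA.compl), Set.indicator_of_notMem fun hx => hx.2 hmem]
  simp

lemma mellinSM_atoms (E J : Finset (Fin n)) {s : Fin n → ℂ} (hs : s ∈ mellinTube n)
    (r u : Fin n → Bool → ℝ) :
    mellinSM E J s (atoms r u) = ∏ i, ∑ β, (r i β : ℂ) * (if i ∈ E then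
      ((if i ∈ J then Real.sign (u i β) else 1 : ℝ) : ℂ) * ((|u i β| : ℝ) : ℂ) ^ s i else 1) := by
  rw [atoms, mellinSM_sum E J hs fun _ _ => integrableSM_toSigned_dirac _,
    Finset.prod_univ_sum, Fintype.piFinset_univ]
  refine Finset.sum_congr rfl fun b _ => ?_
  rw [mellinSM_toSigned_dirac E J hs, mellinChar, Finset.prod_mul_distrib (s := Finset.univ),
    Finset.prod_ite_mem, Finset.univ_inter, Complex.ofReal_prod]

/-- The weights of `deltaJ`, one coordinate at a time. -/
def signWeight (J : Finset (Fin n)) (i : Fin n) (β : Bool) : ℝ :=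
  if i ∈ J then if β then 1 else -1 else 1

lemma deltaJ_eq_smul_atoms (J : Finset (Fin n)) :
    deltaJ J = ((2 : ℝ) ^ n)⁻¹ • atoms (signWeight J) fun _ β => if β then 1 else -1 := by
  simp only [deltaJ, atoms, signWeight, Finset.prod_ite_mem, Finset.univ_inter]
  rfl

lemma integrableSM_deltaJ (J : Finset (Fin n)) : IntegrableSM (deltaJ J) := by
  rw [deltaJ_eq_smul_atoms]
  exact (integrableSM_atoms _ _).smul _

lemma concOn_deltaJ (J : Finset (Fin n)) : ConcOn (deltaJ J) (setA Finset.univ) := by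
  have hA := measurableSet_setA (Finset.univ : Finset (Fin n))
  refine concOn_of_restrict_compl hA (VectorMeasure.ext fun B hB => ?_)
  have h0 : ConcOn (atoms (signWeight J) fun _ β => if β then (1 : ℝ) else -1)
      (setA Finset.univ) := concOn_atoms _ _ fun i β => by cases β <;> simp
  rw [deltaJ_eq_smul_atoms, VectorMeasure.restrict_apply _ hA.compl hB, _root_.smul_apply,
    SignedMeasure.null_of_totalVariation_zero _ (measure_mono_null Set.inter_subset_right h0)]
  simp

lemma mellinSM_deltaJ {E J' : Finset (Fin n)} (hJ' : J' ⊆ E) (J : Finset (Fin n))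
    {s : Fin n → ℂ} (hs : s ∈ mellinTube n) :
    mellinSM E J' s (deltaJ J) = if J' = J then 1 else 0 := by
  rw [deltaJ_eq_smul_atoms, mellinSM_smul E J' hs (integrableSM_atoms _ _), mellinSM_atoms _ _ hs]
  have hfac (i : Fin n) : (∑ β : Bool, (signWeight J i β : ℂ) * (if i ∈ E then
      ((if i ∈ J' then Real.sign (if β then 1 else -1) else 1 : ℝ) : ℂ)
        * ((|if β then (1 : ℝ) else -1| : ℝ) : ℂ) ^ s i else 1))
      = if i ∈ J' ↔ i ∈ J then 2 else 0 := by
    have hE : i ∈ J' → i ∈ E := fun h => hJ' h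
    have h1 : Real.sign (-1) = -1 := Real.sign_of_neg (by norm_num)
    by_cases h1E : i ∈ E <;> by_cases h1J : i ∈ J <;> by_cases h1J' : i ∈ J' <;>
      simp_all [signWeight] <;> norm_num
  rw [Finset.prod_congr rfl fun i _ => hfac i]
  split_ifs with h
  · simp [h]
  · have : ∃ i, ¬(i ∈ J' ↔ i ∈ J) := by
      by_contra! hall
      exact h (Finset.ext hall)
    obtain ⟨i, hi⟩ := this
    rw [Finset.prod_eq_zero (Finset.mem_univ i) (if_neg hi), mul_zero]

lemma exists_concOn_mellinSM (E : Finset (Fin n)) : ∃ κ : SM n, IntegrableSM κ ∧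
    ConcOn κ (setA E) ∧
    (∀ E' J', E' ≠ E → ∀ s ∈ mellinTube n, mellinSM E' J' s κ = 0) ∧
    ∀ J, ∃ s ∈ mellinTube n, mellinSM E J s κ ≠ 0 := by
  set r : Fin n → Bool → ℝ := fun i β => if i ∈ E then if β then 1 else -1 else 1 with hr
  set u : Fin n → Bool → ℝ := fun i β => if i ∈ E then if β then 2 else 1 else 0 with hu
  refine ⟨atoms r u, integrableSM_atoms _ _, concOn_atoms _ _ fun i β => ?_,
    fun E' J' hE' s hs => ?_, fun J => ?_⟩
  · by_cases hi : i ∈ E <;> cases β <;> simp [hu, hi]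
  · rw [mellinSM_atoms _ _ hs]
    have : ∃ i, ¬(i ∈ E' ↔ i ∈ E) := by
      by_contra! hall
      exact hE' (Finset.ext hall)
    obtain ⟨i, hi⟩ := this
    refine Finset.prod_eq_zero (Finset.mem_univ i) ?_
    have := ne_zero_of_mem_mellinTube hs i
    by_cases h1 : i ∈ E <;> by_cases h2 : i ∈ E' <;> simp_all
  · set c : ℝ := (n : ℝ)⁻¹ / 2 with hc
    have hpos (i : Fin n) : 0 < (n : ℝ)⁻¹ := inv_pos.2 (Nat.cast_pos.2 i.pos)
    have hs : (fun _ => (c : ℂ)) ∈ mellinTube n := fun i => by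
      have := hpos i
      rw [Complex.ofReal_re]
      constructor <;> linarith
    refine ⟨_, hs, ?_⟩
    rw [mellinSM_atoms _ _ hs, Finset.prod_ne_zero_iff]
    intro i _
    by_cases h1 : i ∈ E
    · have h2 : (1 : ℝ) < 2 ^ c := Real.one_lt_rpow one_lt_two (half_pos (hpos i))
      have h3 : ((2 : ℝ) : ℂ) ^ (c : ℂ) - 1 ≠ 0 := by
        rw [← Complex.ofReal_cpow zero_le_two, sub_ne_zero]
        exact_mod_cast h2.ne'
      have h4 : Real.sign 2 = 1 := Real.sign_of_pos two_pos
      simpa [hr, hu, h1, h4, sub_eq_add_neg] using h3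
    · simp [hr, h1]

end Atoms

section Universality

variable {n : ℕ}

lemma IntegrableSM.Rres_Pmap {ν : SM n} (hν : IntegrableSM ν) (E : Finset (Fin n)) :
    IntegrableSM (Rres E (Pmap E ν)) :=
  (hν.map (measurable_projE E) (e2_projE_le E)).restrict (measurableSet_setA E)

lemma mellinSM_Rres_Pmap (E J : Finset (Fin n)) {s : Fin n → ℂ} (hs : s ∈ mellinTube n)
    {ν : SM n} (hν : IntegrableSM ν) : mellinSM E J s (Rres E (Pmap E ν)) = mellinSM E J s ν := by
  have hP := measurable_projE E
  have hA := measurableSet_setA E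
  have hle := e2_projE_le E
  have h1 : mellinSM E J s (ν.map (projE E)) = 1 * mellinSM E J s ν :=
    mellinSM_map E J hs hν hP hle fun x => by
      rw [one_mul]
      exact mellinChar_congr J s fun i hi => if_pos hi
  rw [one_mul] at h1
  rw [← h1]
  refine mellinSM_restrict E J hs (hν.map hP hle) hA ?_
  have hN : MeasurableSet ((setA E)ᶜ ∩ {x : Fin n → ℝ | mellinChar E J s x ≠ 0}) :=
    hA.compl.inter (measurable_mellinChar E J s (measurableSet_singleton 0).compl)
  have hempty : projE E ⁻¹' ((setA E)ᶜ ∩ {x : Fin n → ℝ | mellinChar E J s x ≠ 0}) = ∅ := by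
    refine Set.eq_empty_of_forall_notMem fun x hx => hx.1 fun i => ?_
    by_cases hi : i ∈ E
    · exact iff_of_true (fun h => hx.2 (mellinChar_eq_zero J hs hi h)) hi
    · exact iff_of_false (not_not.2 (if_neg hi)) hi
  have h0 : SignedMeasure.totalVariation (ν.map (projE E))
      ((setA E)ᶜ ∩ {x : Fin n → ℝ | mellinChar E J s x ≠ 0}) = 0 := by
    refine le_antisymm ((((isDiff_jordan ν).map hP).totalVariation_le _).trans_eq ?_) zero_le
    rw [Measure.add_apply, Measure.map_apply hP hN, Measure.map_apply hP hN, hempty,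
      measure_empty, measure_empty, add_zero]
  rw [ae_iff]
  refine measure_mono_null (fun x hx => ?_) h0
  exact Classical.not_imp.1 hx

lemma mellinSM_Tmap {E J : Finset (Fin n)} (hJ : J ⊆ E) (F : Finset (Fin n)) {s : Fin n → ℂ}
    (hs : s ∈ mellinTube n) {μ : SM n} (hμ : IntegrableSM μ) :
    mellinSM E J s (Tmap F μ) = (-1) ^ (J ∩ F).card * mellinSM E J s μ :=
  mellinSM_map E J hs hμ (measurable_flipE F) (fun x => (e2_flipE F x).le)
    (mellinChar_flipE hJ F s)

lemma concOn_mconv_deltaJ (E J : Finset (Fin n)) {μ : SM n} (hμ : ConcOn μ (setA E)) :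
    ConcOn (mconv (deltaJ J) μ) (setA E) :=
  (concOn_deltaJ J).mconv hμ (measurableSet_setA E) fun _ hx _ hy => mul_mem_setA hx hy

/-- Universality from the non-vanishing condition. -/
lemma universal_of_forall_ne_zero {𝓔 Fe Fo : Set (Finset (Fin n))} {ν : SM n}
    (hν : IntegrableSM ν)
    (h : ∀ E ∈ 𝓔, ∀ J ∈ JsetE E Fe Fo, mconv (deltaJ J) (Rres E (Pmap E ν)) ≠ 0) :
    Universal ν (MclassInt (⋃ E ∈ 𝓔, setA E) Fe Fo) := by
  rintro μ ⟨hμ, hconc, heven, hodd⟩ h0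
  refine eq_zero_of_forall_mellinSM hμ fun E => ?_
  by_cases hE : E ∈ 𝓔
  · right
    intro J hJ
    by_cases hJE : J ∈ JsetE E Fe Fo
    · have hmul : ∀ s ∈ mellinTube n, mellinSM E J s ν * mellinSM E J s μ = 0 := fun s hs => by
        rw [← mellinSM_mconv E J hs hν hμ, h0, mellinSM_zero]
      refine (mellinSM_eq_zero_or_eq_zero E J hν hμ hmul).resolve_left fun hν0 =>
        h E hE J hJE ?_
      have hR := hν.Rres_Pmap E
      refine eq_zero_of_mellinSM_eq_zero ((integrableSM_deltaJ J).mconv hR)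
        (concOn_mconv_deltaJ E J (concOn_restrict _ (measurableSet_setA E))) fun J' hJ' s hs => ?_
      rw [mellinSM_mconv E J' hs (integrableSM_deltaJ J) hR, mellinSM_deltaJ hJ' J hs,
        mellinSM_Rres_Pmap E J' hs hν]
      split_ifs with hJJ
      · rw [hJJ, hν0 s hs, mul_zero]
      · rw [zero_mul]
    · intro s hs
      simp only [JsetE, Set.mem_ofPred_eq, hJ, true_and, not_and_or, not_forall] at hJE
      rcases hJE with ⟨F, hF, hcard⟩ | ⟨F, hF, hcard⟩
      · have := mellinSM_Tmap hJ F hs hμ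
        rw [heven F hF, (Nat.not_even_iff_odd.1 hcard).neg_one_pow, neg_one_mul] at this
        exact self_eq_neg.1 this
      · have := mellinSM_Tmap hJ F hs hμ
        rw [hodd F hF, mellinSM_neg E J hs hμ, (Nat.not_odd_iff_even.1 hcard).neg_one_pow,
          one_mul] at this
        exact neg_eq_self.1 this
  · left
    refine measure_mono_null (show setA E ⊆ (⋃ E ∈ 𝓔, setA E)ᶜ from fun x hx hx' => ?_) hconc
    obtain ⟨E', hE', hxE'⟩ := Set.mem_iUnion₂.1 hx'
    exact hE (eq_of_mem_setA hx hxE' ▸ hE')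

/-- A witness against universality when the non-vanishing condition fails. -/
lemma not_universal_of_eq_zero {𝓔 Fe Fo : Set (Finset (Fin n))} {ν : SM n}
    (hν : IntegrableSM ν) {E J : Finset (Fin n)} (hE : E ∈ 𝓔) (hJ : J ∈ JsetE E Fe Fo)
    (h : mconv (deltaJ J) (Rres E (Pmap E ν)) = 0) :
    ¬Universal ν (MclassInt (⋃ E ∈ 𝓔, setA E) Fe Fo) := by
  intro huniv
  obtain ⟨hJE, hJe, hJo⟩ := hJ
  obtain ⟨κ, hκ, hκc, hκ0, hκ1⟩ := exists_concOn_mellinSM E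
  set μ : SM n := mconv (deltaJ J) κ with hμdef
  have hμ : IntegrableSM μ := (integrableSM_deltaJ J).mconv hκ
  have hmellin : ∀ E' J', J' ⊆ E' → ∀ s ∈ mellinTube n,
      mellinSM E' J' s μ = if J' = J then mellinSM E' J s κ else 0 := fun E' J' hJ' s hs => by
    rw [hμdef, mellinSM_mconv E' J' hs (integrableSM_deltaJ J) hκ, mellinSM_deltaJ hJ' J hs]
    split_ifs with hJJ
    · rw [hJJ, one_mul]
    · rw [zero_mul]
  have hν0 : ∀ s ∈ mellinTube n, mellinSM E J s ν = 0 := fun s hs => by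
    have h1 := mellinSM_mconv E J hs (integrableSM_deltaJ J) (hν.Rres_Pmap E)
    rw [h, mellinSM_zero, mellinSM_deltaJ hJE J hs, if_pos rfl, one_mul,
      mellinSM_Rres_Pmap E J hs hν] at h1
    exact h1.symm
  have hcases : ∀ E' J', J' ⊆ E' → ∀ s ∈ mellinTube n, mellinSM E' J' s μ = 0 ∨
      E' = E ∧ J' = J := fun E' J' hJ' s hs => by
    rw [hmellin E' J' hJ' s hs]
    by_cases h1 : J' = J
    · by_cases h2 : E' = E
      · exact .inr ⟨h2, h1⟩
      · exact .inl (by rw [if_pos h1, hκ0 E' J h2 s hs])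
    · exact .inl (if_neg h1)
  have hT (F : Finset (Fin n)) : IntegrableSM (Tmap F μ) :=
    hμ.map (measurable_flipE F) fun x => (e2_flipE F x).le
  have hmem : μ ∈ MclassInt (⋃ E ∈ 𝓔, setA E) Fe Fo := by
    refine ⟨hμ, (concOn_mconv_deltaJ E J hκc).mono (Set.subset_biUnion_of_mem hE),
      fun F hF => ?_, fun F hF => ?_⟩
    · refine add_neg_eq_zero.1 (eq_zero_of_forall_mellinSM ((hT F).add hμ.neg) fun E' => .inr
        fun J' hJ' s hs => ?_)
      rw [mellinSM_add E' J' hs (hT F) hμ.neg, mellinSM_neg E' J' hs hμ,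
        mellinSM_Tmap hJ' F hs hμ]
      rcases hcases E' J' hJ' s hs with h0 | ⟨-, rfl⟩
      · simp [h0]
      · rw [(hJe F hF).neg_one_pow, one_mul, add_neg_cancel]
    · refine add_eq_zero_iff_eq_neg.1 (eq_zero_of_forall_mellinSM ((hT F).add hμ) fun E' => .inr
        fun J' hJ' s hs => ?_)
      rw [mellinSM_add E' J' hs (hT F) hμ, mellinSM_Tmap hJ' F hs hμ]
      rcases hcases E' J' hJ' s hs with h0 | ⟨-, rfl⟩
      · simp [h0]
      · rw [(hJo F hF).neg_one_pow, neg_one_mul, neg_add_cancel]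
  have hconv : mconv ν μ = 0 :=
    eq_zero_of_forall_mellinSM (hν.mconv hμ) fun E' => .inr fun J' hJ' s hs => by
      rw [mellinSM_mconv E' J' hs hν hμ]
      rcases hcases E' J' hJ' s hs with h0 | ⟨rfl, rfl⟩
      · rw [h0, mul_zero]
      · rw [hν0 s hs, zero_mul]
  obtain ⟨s, hs, hne⟩ := hκ1 J
  refine hne ?_
  rw [← if_pos (c := J = J) (t := mellinSM E J s κ) (e := 0) rfl, ← hmellin E J hJE s hs,
    huniv μ hmem hconv, mellinSM_zero]

end Universality

/-- Theorem: characterisation of universality on `ℳ^int(𝓔; Fe, Fo)`. -/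
theorem stmt1 {n : ℕ} (hn : 1 ≤ n) (𝓔 Fe Fo : Set (Finset (Fin n))) (ν : SM n)
    (hint : IntegrableSM ν) :
    Universal ν (MclassInt (⋃ E ∈ 𝓔, setA E) Fe Fo) ↔
      ∀ E ∈ 𝓔, ∀ J ∈ JsetE E Fe Fo, mconv (deltaJ J) (Rres E (Pmap E ν)) ≠ 0 := by
  refine ⟨fun hU E hE J hJ h0 => not_universal_of_eq_zero hint hE hJ h0 hU,
    universal_of_forall_ne_zero hint⟩

end
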